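/- Let G be a graph factored into a connected bipartite graph H and a graph K with no isolated vertex, and suppose G is not connected. Then K is a regular bipartite graph, the order n of G is even, and G is a disjoint union of two non-bipartite connected graphs. -/

import Mathlib

open SimpleGraph Matrix

namespace SimpleGraph

section Factorization

variable {V : Type*} {G H K : SimpleGraph V}

theorem adj_iff_of_adjMatrix_eq_mul [Fintype V] [DecidableRel G.Adj] [DecidableRel H.Adj]
    [DecidableRel K.Adj] (hfac : G.adjMatrix ℝ = H.adjMatrix ℝ * K.adjMatrix ℝ) (u w : V) :
    G.Adj u w ↔ ∃ v, H.Adj u v ∧ K.Adj v w := by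
  have h := congrFun (congrFun hfac u) w
  simp only [Matrix.mul_apply, adjMatrix_apply, ← ite_and, mul_ite, mul_one, mul_zero] at h
  constructor
  · intro hG
    by_contra! hcon
    rw [if_pos hG, Finset.sum_eq_zero] at h
    · exact one_ne_zero h
    · intro v _
      exact if_neg fun hv => hcon v hv.2 hv.1
  · rintro ⟨v, huv, hvw⟩
    by_contra hG
    rw [if_neg hG, eq_comm, Finset.sum_eq_zero_iff_of_nonneg] at h
    · simpa [huv, hvw] using h v (Finset.mem_univ v)
    · intro v _
      split_ifs <;> norm_num

theorem eq_of_adjMatrix_eq_mul [Fintype V] [DecidableRel G.Adj] [DecidableRel H.Adj]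
    [DecidableRel K.Adj] (hfac : G.adjMatrix ℝ = H.adjMatrix ℝ * K.adjMatrix ℝ) {u v v' w : V}
    (huv : H.Adj u v) (hvw : K.Adj v w) (huv' : H.Adj u v') (hvw' : K.Adj v' w) : v = v' := by
  classical
  by_contra hne
  have h := congrFun (congrFun hfac u) w
  have hle : ∑ x ∈ {v, v'}, H.adjMatrix ℝ u x * K.adjMatrix ℝ x w ≤
      ∑ x, H.adjMatrix ℝ u x * K.adjMatrix ℝ x w := by
    refine Finset.sum_le_sum_of_subset_of_nonneg (Finset.subset_univ _) fun x _ _ => ?_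
    simp only [adjMatrix_apply]
    split_ifs <;> norm_num
  rw [Finset.sum_pair hne, ← Matrix.mul_apply, ← h] at hle
  simp only [adjMatrix_apply, huv, hvw, huv', hvw', if_true] at hle
  split_ifs at hle <;> norm_num at hle

theorem degree_le_of_adjMatrix_eq_mul [Fintype V] [DecidableRel G.Adj] [DecidableRel H.Adj]
    [DecidableRel K.Adj] (hfac : G.adjMatrix ℝ = H.adjMatrix ℝ * K.adjMatrix ℝ) {u v : V}
    (huv : H.Adj u v) : K.degree v ≤ K.degree u := by
  have hG := adj_iff_of_adjMatrix_eq_mul hfac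
  have hex : ∀ w, ∃ z, K.Adj v w → H.Adj w z ∧ K.Adj z u := by
    intro w
    by_cases hw : K.Adj v w
    · obtain ⟨z, hz⟩ := (hG w u).1 ((hG u w).2 ⟨v, huv, hw⟩).symm
      exact ⟨z, fun _ => hz⟩
    · exact ⟨w, fun h => absurd h hw⟩
  choose f hf using hex
  refine Finset.card_le_card_of_injOn f ?_ ?_
  · intro w hw
    simpa using (hf w (by simpa using hw)).2.symm
  · intro w hw w' hw' hww
    have hw : K.Adj v w := by simpa using hw
    have hw' : K.Adj v w' := by simpa using hw'
    exact eq_of_adjMatrix_eq_mul hfac (hf w hw).1.symm hw.symm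
      (hww ▸ (hf w' hw').1.symm) hw'.symm

theorem isRegularOfDegree_of_adjMatrix_eq_mul [Fintype V] [DecidableRel G.Adj]
    [DecidableRel H.Adj] [DecidableRel K.Adj]
    (hfac : G.adjMatrix ℝ = H.adjMatrix ℝ * K.adjMatrix ℝ) (hH : H.Preconnected) (v : V) :
    K.IsRegularOfDegree (K.degree v) := by
  intro w
  obtain ⟨p⟩ := hH w v
  induction p with
  | nil => rfl
  | cons h _ ih =>
    exact (le_antisymm (degree_le_of_adjMatrix_eq_mul hfac h.symm)
      (degree_le_of_adjMatrix_eq_mul hfac h)).trans ih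

theorem exists_adj_walk_of_walk_adj (hG : ∀ u w, G.Adj u w ↔ ∃ v, H.Adj u v ∧ K.Adj v w)
    {a w b : V} (p : H.Walk a w) (hwb : K.Adj w b) :
    ∃ c, K.Adj a c ∧ ∃ q : H.Walk c b, q.length = p.length := by
  induction p with
  | nil => exact ⟨b, hwb, .nil, rfl⟩
  | @cons x y _ hxy p ih =>
    obtain ⟨c, hyc, q, hq⟩ := ih hwb
    obtain ⟨d, hcd, hdx⟩ := (hG c x).1 ((hG x c).2 ⟨y, hxy, hyc⟩).symm
    exact ⟨d, hdx.symm, .cons hcd.symm q, by simp [hq]⟩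

theorem exists_walk_of_walk_walk (hG : ∀ u w, G.Adj u w ↔ ∃ v, H.Adj u v ∧ K.Adj v w)
    {u w z : V} (p : H.Walk u w) (q : K.Walk w z) (hpq : p.length = q.length) :
    ∃ r : G.Walk u z, r.length = p.length := by
  induction q generalizing u with
  | nil =>
    obtain rfl := Walk.eq_of_length_eq_zero hpq
    exact ⟨.nil, hpq.symm⟩
  | cons hwb q ih =>
    cases p with
    | nil => simp at hpq
    | @cons _ a _ hua p =>
      obtain ⟨c, hac, p', hp'⟩ := exists_adj_walk_of_walk_adj hG p hwb
      simp only [Walk.length_cons, add_left_inj] at hpq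
      obtain ⟨r, hr⟩ := ih p' (hp'.trans hpq)
      exact ⟨.cons ((hG u c).2 ⟨a, hua, hac⟩) r, by simp [hr, hp']⟩

theorem Adj.exists_walk_length_two_mul {v w : V} (h : K.Adj v w) (m : ℕ) :
    ∃ q : K.Walk v v, q.length = 2 * m := by
  induction m with
  | zero => exact ⟨.nil, rfl⟩
  | succ m ih =>
    obtain ⟨q, hq⟩ := ih
    exact ⟨.cons h (.cons h.symm q), by simp [hq]; ring⟩

theorem reachable_of_color_eq (hG : ∀ u w, G.Adj u w ↔ ∃ v, H.Adj u v ∧ K.Adj v w)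
    (hH : H.Preconnected) (c : H.Coloring Bool) (hK : ∀ v, ∃ w, K.Adj v w) {u v : V}
    (huv : c u = c v) : G.Reachable u v := by
  obtain ⟨p⟩ := hH u v
  obtain ⟨m, hm⟩ := (c.even_length_iff_congr p).2 (by rw [huv])
  obtain ⟨w, hw⟩ := hK v
  obtain ⟨q, hq⟩ := hw.exists_walk_length_two_mul m
  obtain ⟨r, -⟩ := exists_walk_of_walk_walk hG p q (by lia)
  exact ⟨r⟩

theorem color_eq_of_adj (hG : ∀ u w, G.Adj u w ↔ ∃ v, H.Adj u v ∧ K.Adj v w)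
    (hH : H.Connected) (c : H.Coloring Bool) (hK : ∀ v, ∃ w, K.Adj v w)
    (hGdisc : ¬ G.Connected) {u v : V} (huv : G.Adj u v) : c u = c v := by
  by_contra hne
  have := hH.nonempty
  have hreach : ∀ {a b : V}, c a = c b → G.Reachable a b :=
    reachable_of_color_eq hG hH.preconnected c hK
  have hu : ∀ a, G.Reachable u a := by
    intro a
    by_cases ha : c u = c a
    · exact hreach ha
    · exact huv.reachable.trans (hreach
        ((Bool.eq_not.2 (Ne.symm hne)).trans (Bool.eq_not.2 (Ne.symm ha)).symm))
  exact hGdisc ⟨fun a b => (hu a).symm.trans (hu b)⟩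

theorem color_ne_of_adj (hG : ∀ u w, G.Adj u w ↔ ∃ v, H.Adj u v ∧ K.Adj v w)
    (hH : H.Connected) (c : H.Coloring Bool) (hK : ∀ v, ∃ w, K.Adj v w)
    (hGdisc : ¬ G.Connected) {v w : V} (hvw : K.Adj v w) : c v ≠ c w := by
  obtain ⟨p⟩ := hH.preconnected v w
  cases p with
  | nil => exact absurd hvw K.irrefl
  | @cons _ u _ hvu _ =>
    rw [← color_eq_of_adj hG hH c hK hGdisc ((hG u w).2 ⟨v, hvu.symm, hvw⟩)]
    exact c.valid hvu

theorem exists_induce_walk {s : Set V} (hs : ∀ ⦃u v⦄, G.Adj u v → u ∈ s → v ∈ s) {u v : V}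
    (p : G.Walk u v) (hu : u ∈ s) :
    ∃ hv : v ∈ s, ∃ q : (G.induce s).Walk ⟨u, hu⟩ ⟨v, hv⟩, q.length = p.length := by
  induction p with
  | nil => exact ⟨hu, .nil, rfl⟩
  | cons h p ih =>
    obtain ⟨hv, q, hq⟩ := ih (hs h hu)
    exact ⟨hv, .cons (by simpa using h) q, by simp [hq]⟩

theorem induce_color_connected_not_colorable
    (hG : ∀ u w, G.Adj u w ↔ ∃ v, H.Adj u v ∧ K.Adj v w)
    (hH : H.Connected) (c : H.Coloring Bool) (hK : ∀ v, ∃ w, K.Adj v w)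
    (hGdisc : ¬ G.Connected) (b : Bool) :
    (G.induce {v | c v = b}).Connected ∧ ¬ (G.induce {v | c v = b}).Colorable 2 := by
  have hs : ∀ ⦃u v⦄, G.Adj u v → u ∈ {v | c v = b} → v ∈ {v | c v = b} := fun u v huv hu =>
    (color_eq_of_adj hG hH c hK hGdisc huv).symm.trans hu
  obtain ⟨u, hu⟩ : ∃ u, c u = b := by
    obtain ⟨v⟩ := hH.nonempty
    obtain ⟨w, hw⟩ := hK v
    have := color_ne_of_adj hG hH c hK hGdisc hw
    by_cases hv : c v = b
    · exact ⟨v, hv⟩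
    · exact ⟨w, (Bool.eq_not.2 this.symm).trans (Bool.eq_not.2 (Ne.symm hv)).symm⟩
  have : Nonempty {v | c v = b} := ⟨⟨u, hu⟩⟩
  refine ⟨⟨?_⟩, ?_⟩
  · rintro ⟨x, hx⟩ ⟨y, hy⟩
    obtain ⟨p⟩ := reachable_of_color_eq hG hH.preconnected c hK (hx.trans hy.symm)
    obtain ⟨_, q, -⟩ := exists_induce_walk hs p hx
    exact ⟨q⟩
  · rintro ⟨d⟩
    obtain ⟨w, huw⟩ := hK u
    obtain ⟨p⟩ := hH.preconnected u w
    have hodd : Odd p.length := by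
      have := color_ne_of_adj hG hH c hK hGdisc huw
      exact (c.odd_length_iff_not_congr p).2 (by grind)
    obtain ⟨m, hm⟩ := hodd
    obtain ⟨q, hq⟩ := huw.exists_walk_length_two_mul m
    obtain ⟨r, hr⟩ := exists_walk_of_walk_walk hG p (.cons huw.symm q) (by simp [hq, hm])
    obtain ⟨_, r', hr'⟩ := exists_induce_walk hs r hu
    have heven : Even r'.length :=
      (((G.induce _).recolorOfEquiv finTwoEquiv d).even_length_iff_congr r').2 Iff.rfl
    rw [hr', hr, hm] at heven
    exact Nat.not_even_two_mul_add_one m heven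

theorem IsRegularOfDegree.even_card_of_coloring [Fintype V] [DecidableRel K.Adj] {r : ℕ}
    (hK : K.IsRegularOfDegree r) (hr : 0 < r) (c : K.Coloring Bool) :
    Even (Fintype.card V) := by
  classical
  have hbip : K.IsBipartiteWith (({v | c v = true} : Finset V) : Set V)
      (({v | ¬ c v = true} : Finset V) : Set V) := by
    refine ⟨?_, ?_⟩
    · rw [Finset.disjoint_coe]
      exact Finset.disjoint_filter_filter_not _ _ _
    · intro v w hvw
      have := c.valid hvw
      simp only [Finset.coe_filter, Finset.mem_univ, true_and, Set.mem_ofPred_eq]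
      grind
  have hsum := isBipartiteWith_sum_degrees_eq hbip
  simp only [hK.degree_eq, Finset.sum_const, smul_eq_mul] at hsum
  have hcard := Nat.eq_of_mul_eq_mul_right hr hsum
  rw [← Finset.card_univ, ← Finset.card_filter_add_card_filter_not (fun v => c v = true), ← hcard]
  exact ⟨_, rfl⟩

end Factorization

end SimpleGraph

theorem stmt16 {n : ℕ} (G H K : SimpleGraph (Fin n))
    [DecidableRel G.Adj] [DecidableRel H.Adj] [DecidableRel K.Adj]
    (hfac : G.adjMatrix ℝ = H.adjMatrix ℝ * K.adjMatrix ℝ)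
    (hHconn : H.Connected) (hHbip : H.Colorable 2)
    (hK : ∀ v, 0 < K.degree v) (hGdisc : ¬ G.Connected) :
    ((∃ r, K.IsRegularOfDegree r) ∧ K.Colorable 2) ∧ Even n ∧
      ∃ s : Set (Fin n),
        (∀ u ∈ s, ∀ v ∉ s, ¬ G.Adj u v) ∧
        (G.induce s).Connected ∧ ¬ (G.induce s).Colorable 2 ∧
        (G.induce sᶜ).Connected ∧ ¬ (G.induce sᶜ).Colorable 2 := by
  have hG := adj_iff_of_adjMatrix_eq_mul hfac
  obtain ⟨d⟩ := hHbip
  let c : H.Coloring Bool := H.recolorOfEquiv finTwoEquiv d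
  have hKadj : ∀ v, ∃ w, K.Adj v w := fun v => (K.degree_pos_iff_exists_adj v).1 (hK v)
  let cK : K.Coloring Bool :=
    Coloring.mk c fun hvw => color_ne_of_adj hG hHconn c hKadj hGdisc hvw
  obtain ⟨v₀⟩ := hHconn.nonempty
  have hreg := isRegularOfDegree_of_adjMatrix_eq_mul hfac hHconn.preconnected v₀
  have hcompl : {v | c v = true}ᶜ = {v | c v = false} := by
    ext v
    simp
  have hpart := induce_color_connected_not_colorable hG hHconn c hKadj hGdisc
  refine ⟨⟨⟨_, hreg⟩, ?_⟩, ?_, {v | c v = true}, ?_, (hpart true).1, (hpart true).2, ?_⟩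
  · simpa using cK.colorable
  · simpa using hreg.even_card_of_coloring (hK v₀) cK
  · intro u hu v hv huv
    exact hv ((color_eq_of_adj hG hHconn c hKadj hGdisc huv).symm.trans hu)
  · rw [hcompl]
    exact hpart false
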